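/- Let β > 0, ε ∈ (0, 1/2), and let (x*, y*, λ*) be a solution of the variational inequality VI(F, θ, Ω). Let (δ_k)_{k≥0} be a sequence of reals with δ_k ≥ 1 for all k and Σ_{k=0}^∞ max{0, δ_{k+1} − δ_k} < ∞, and suppose there exists c > 0 such that δ_k·‖z‖² − (1/(2ε))·‖Bz‖² ≥ c·‖z‖² for all k ≥ 0 and all z ∈ ℝ^{n₂}. Let y^0 ∈ Y, λ^0 ∈ ℝ^m, and suppose that for every k ≥ 0 the triple (x^{k+1}, y^{k+1}, λ^{k+1}) is a linearized ADMM step from (y^k, λ^k) with parameters β, δ_k. Then: (a) the sequence a_k = δ_kβ·‖y^{k+1} − y*‖² + (1/β)·‖λ^{k+1} − λ*‖² converges to a finite limit; (b) ‖y^{k+1} − y^k‖ → 0 and ‖λ^{k+1} − λ^k‖ → 0 as k → ∞. -/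

import Mathlib

open Matrix Filter

variable {m n₁ n₂ : ℕ}

/-- `(x*, y*, λ*)` is a solution of the variational inequality `VI(F, θ, Ω)`. -/
def VISolution (A : Matrix (Fin m) (Fin n₁) ℝ) (B : Matrix (Fin m) (Fin n₂) ℝ)
    (b : Fin m → ℝ) (X : Set (Fin n₁ → ℝ)) (Y : Set (Fin n₂ → ℝ))
    (θ₁ : (Fin n₁ → ℝ) → ℝ) (θ₂ : (Fin n₂ → ℝ) → ℝ)
    (xs : Fin n₁ → ℝ) (ys : Fin n₂ → ℝ) (ls : Fin m → ℝ) : Prop :=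
  xs ∈ X ∧ ys ∈ Y ∧
    (∀ x ∈ X, θ₁ x - θ₁ xs + (x - xs) ⬝ᵥ (-(Aᵀ *ᵥ ls)) ≥ 0) ∧
    (∀ y ∈ Y, θ₂ y - θ₂ ys + (y - ys) ⬝ᵥ (-(Bᵀ *ᵥ ls)) ≥ 0) ∧
    A *ᵥ xs + B *ᵥ ys = b

/-- `(x⁺, y⁺, λ⁺)` is a linearized ADMM step from `(yk, λk)` with parameters
`β, δ`. -/
def ADMMStep (A : Matrix (Fin m) (Fin n₁) ℝ) (B : Matrix (Fin m) (Fin n₂) ℝ)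
    (b : Fin m → ℝ) (X : Set (Fin n₁ → ℝ)) (Y : Set (Fin n₂ → ℝ))
    (θ₁ : (Fin n₁ → ℝ) → ℝ) (θ₂ : (Fin n₂ → ℝ) → ℝ) (β δ : ℝ)
    (yk : Fin n₂ → ℝ) (lk : Fin m → ℝ)
    (xp : Fin n₁ → ℝ) (yp : Fin n₂ → ℝ) (lp : Fin m → ℝ) : Prop :=
  xp ∈ X ∧ yp ∈ Y ∧
    (∀ x ∈ X, θ₁ x - θ₁ xp +
      (x - xp) ⬝ᵥ (-(Aᵀ *ᵥ lk) + β • (Aᵀ *ᵥ (A *ᵥ xp + B *ᵥ yk - b))) ≥ 0) ∧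
    (∀ y ∈ Y, θ₂ y - θ₂ yp +
      (y - yp) ⬝ᵥ (-(Bᵀ *ᵥ lk) + β • (Bᵀ *ᵥ (A *ᵥ xp + B *ᵥ yk - b))
        + (β * δ) • (yp - yk)) ≥ 0) ∧
    lp = lk - β • (A *ᵥ xp + B *ᵥ yp - b)

theorem dotProduct_transpose_mulVec {p q : ℕ} (M : Matrix (Fin p) (Fin q) ℝ)
    (u : Fin q → ℝ) (v : Fin p → ℝ) : u ⬝ᵥ (Mᵀ *ᵥ v) = (M *ᵥ u) ⬝ᵥ v := by
  rw [dotProduct_mulVec, vecMul_transpose]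

/-- Deterministic Robbins–Siegmund lemma. -/
theorem tendsto_of_add_le_one_add_mul {a d s : ℕ → ℝ} (ha : ∀ k, 0 ≤ a k) (hd : ∀ k, 0 ≤ d k)
    (hs : ∀ k, 0 ≤ s k) (hsum : Summable s)
    (h : ∀ k, a (k + 1) + d (k + 1) ≤ (1 + s k) * a k) :
    (∃ L, Tendsto a atTop (nhds L)) ∧ Tendsto d atTop (nhds 0) := by
  set P : ℕ → ℝ := fun k => ∏ i ∈ Finset.range k, (1 + s i) with hP
  have hPpos : ∀ k, 0 < P k := fun k => Finset.prod_pos fun i _ => by linarith [hs i]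
  have hPlim : Tendsto P atTop (nhds (∏' i, (1 + s i))) :=
    (Real.multipliable_one_add_of_summable hsum).hasProd.tendsto_prod_nat
  have hanti : Antitone fun k => a k / P k := by
    refine antitone_nat_of_succ_le fun k => ?_
    have h1 : 0 < 1 + s k := by linarith [hs k]
    have hPs : P (k + 1) = P k * (1 + s k) := Finset.prod_range_succ _ _
    rw [hPs, div_le_div_iff₀ (mul_pos (hPpos k) h1) (hPpos k)]
    have h2 : a (k + 1) ≤ (1 + s k) * a k := by linarith [h k, hd (k + 1)]
    nlinarith [mul_le_mul_of_nonneg_right h2 (hPpos k).le]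
  have hbdd : BddBelow (Set.range fun k => a k / P k) :=
    ⟨0, by rintro _ ⟨k, rfl⟩; exact div_nonneg (ha k) (hPpos k).le⟩
  obtain ⟨L, hL⟩ : ∃ L, Tendsto a atTop (nhds L) := by
    refine ⟨_, ((tendsto_atTop_ciInf hanti hbdd).mul hPlim).congr fun k => ?_⟩
    exact div_mul_cancel₀ _ (hPpos k).ne'
  refine ⟨⟨L, hL⟩, (tendsto_add_atTop_iff_nat 1).1 ?_⟩
  have hlim : Tendsto (fun k => (1 + s k) * a k - a (k + 1)) atTop (nhds 0) := by
    simpa using ((hsum.tendsto_atTop_zero.const_add 1).mul hL).sub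
      ((tendsto_add_atTop_iff_nat 1).2 hL)
  exact squeeze_zero (fun k => hd (k + 1)) (fun k => by linarith [h k]) hlim

/-- Fejér-type contraction of a linearized ADMM step towards a solution, before the cross term
is estimated. -/
theorem ADMMStep.contraction_cross {A : Matrix (Fin m) (Fin n₁) ℝ} {B : Matrix (Fin m) (Fin n₂) ℝ}
    {b : Fin m → ℝ} {X : Set (Fin n₁ → ℝ)} {Y : Set (Fin n₂ → ℝ)}
    {θ₁ : (Fin n₁ → ℝ) → ℝ} {θ₂ : (Fin n₂ → ℝ) → ℝ} {β δ : ℝ} (hβ : 0 < β)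
    {xs : Fin n₁ → ℝ} {ys : Fin n₂ → ℝ} {ls : Fin m → ℝ}
    (hsol : VISolution A B b X Y θ₁ θ₂ xs ys ls)
    {yk : Fin n₂ → ℝ} {lk : Fin m → ℝ} {xp : Fin n₁ → ℝ} {yp : Fin n₂ → ℝ} {lp : Fin m → ℝ}
    (hstep : ADMMStep A B b X Y θ₁ θ₂ β δ yk lk xp yp lp) :
    δ * β * ((yp - ys) ⬝ᵥ (yp - ys)) + (1 / β) * ((lp - ls) ⬝ᵥ (lp - ls))
        + β * δ * ((yp - yk) ⬝ᵥ (yp - yk)) + (1 / β) * ((lp - lk) ⬝ᵥ (lp - lk))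
        + 2 * ((lp - lk) ⬝ᵥ (B *ᵥ (yp - yk)))
      ≤ δ * β * ((yk - ys) ⬝ᵥ (yk - ys)) + (1 / β) * ((lk - ls) ⬝ᵥ (lk - ls)) := by
  obtain ⟨hxs, hys, hx, hy, rfl⟩ := hsol
  obtain ⟨hxp, hyp, hx', hy', rfl⟩ := hstep
  have h₁ := add_nonneg (hx xp hxp) (hx' xs hxs)
  have h₂ := add_nonneg (hy yp hyp) (hy' ys hys)
  simp only [dotProduct_add, dotProduct_neg, dotProduct_smul, dotProduct_transpose_mulVec,
    smul_eq_mul] at h₁ h₂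
  simp only [mulVec_sub] at h₁ h₂ ⊢
  generalize A *ᵥ xp = p, A *ᵥ xs = ps, B *ᵥ yp = q, B *ᵥ yk = qk, B *ᵥ ys = qs at *
  have e : 2 * (((p - ps) ⬝ᵥ (lk - ls) - β * ((p - ps) ⬝ᵥ (p + qk - (ps + qs))))
        + ((q - qs) ⬝ᵥ (lk - ls) - β * ((q - qs) ⬝ᵥ (p + qk - (ps + qs)))))
      = (1 / β) * ((lk - ls) ⬝ᵥ (lk - ls))
        - (1 / β) * ((lk - β • (p + q - (ps + qs)) - ls) ⬝ᵥ (lk - β • (p + q - (ps + qs)) - ls))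
        - (1 / β) * ((lk - β • (p + q - (ps + qs)) - lk) ⬝ᵥ (lk - β • (p + q - (ps + qs)) - lk))
        - 2 * ((lk - β • (p + q - (ps + qs)) - lk) ⬝ᵥ (q - qk)) := by
    simp only [dotProduct, Finset.mul_sum, ← Finset.sum_add_distrib, ← Finset.sum_sub_distrib]
    refine Finset.sum_congr rfl fun i _ => ?_
    simp only [Pi.sub_apply, Pi.add_apply, Pi.smul_apply, smul_eq_mul]
    field_simp
    ring
  have e' : 2 * ((ys - yp) ⬝ᵥ (yp - yk))
      = (yk - ys) ⬝ᵥ (yk - ys) - (yp - ys) ⬝ᵥ (yp - ys) - (yp - yk) ⬝ᵥ (yp - yk) := by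
    simp only [dotProduct, Finset.mul_sum, ← Finset.sum_sub_distrib]
    refine Finset.sum_congr rfl fun i _ => ?_
    simp only [Pi.sub_apply]
    ring
  have h₁' : 0 ≤ (p - ps) ⬝ᵥ (lk - ls) - β * ((p - ps) ⬝ᵥ (p + qk - (ps + qs))) := by
    rw [← neg_sub p ps, neg_dotProduct, neg_dotProduct] at h₁
    rw [dotProduct_sub _ lk ls]
    linarith
  have h₂' : 0 ≤ (q - qs) ⬝ᵥ (lk - ls) - β * ((q - qs) ⬝ᵥ (p + qk - (ps + qs)))
      + β * δ * ((ys - yp) ⬝ᵥ (yp - yk)) := by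
    rw [← neg_sub q qs, neg_dotProduct, neg_dotProduct] at h₂
    rw [dotProduct_sub _ lk ls]
    linarith
  linear_combination 2 * h₁' + 2 * h₂' + e + β * δ * e'

theorem neg_two_mul_dotProduct_le {p : ℕ} (u v : Fin p → ℝ) {t : ℝ} (ht : 0 < t) :
    -(2 * (u ⬝ᵥ v)) ≤ t * (u ⬝ᵥ u) + (1 / t) * (v ⬝ᵥ v) := by
  simp only [dotProduct, Finset.mul_sum, ← Finset.sum_neg_distrib, ← Finset.sum_add_distrib]
  refine Finset.sum_le_sum fun i _ => ?_
  have h : t * (u i * u i) + 1 / t * (v i * v i) + 2 * (u i * v i)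
      = (1 / t) * (t * u i + v i) ^ 2 := by
    field_simp
    ring
  have : 0 ≤ (1 / t) * (t * u i + v i) ^ 2 := by positivity
  linarith

theorem ADMMStep.contraction {A : Matrix (Fin m) (Fin n₁) ℝ} {B : Matrix (Fin m) (Fin n₂) ℝ}
    {b : Fin m → ℝ} {X : Set (Fin n₁ → ℝ)} {Y : Set (Fin n₂ → ℝ)}
    {θ₁ : (Fin n₁ → ℝ) → ℝ} {θ₂ : (Fin n₂ → ℝ) → ℝ} {β δ ε c : ℝ} (hβ : 0 < β) (hε : 0 < ε)
    (hcoerc : ∀ z : Fin n₂ → ℝ,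
      δ * (z ⬝ᵥ z) - (1 / (2 * ε)) * ((B *ᵥ z) ⬝ᵥ (B *ᵥ z)) ≥ c * (z ⬝ᵥ z))
    {xs : Fin n₁ → ℝ} {ys : Fin n₂ → ℝ} {ls : Fin m → ℝ}
    (hsol : VISolution A B b X Y θ₁ θ₂ xs ys ls)
    {yk : Fin n₂ → ℝ} {lk : Fin m → ℝ} {xp : Fin n₁ → ℝ} {yp : Fin n₂ → ℝ} {lp : Fin m → ℝ}
    (hstep : ADMMStep A B b X Y θ₁ θ₂ β δ yk lk xp yp lp) :
    δ * β * ((yp - ys) ⬝ᵥ (yp - ys)) + (1 / β) * ((lp - ls) ⬝ᵥ (lp - ls))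
        + (β * c * ((yp - yk) ⬝ᵥ (yp - yk))
          + (1 - 2 * ε) / β * ((lp - lk) ⬝ᵥ (lp - lk)))
      ≤ δ * β * ((yk - ys) ⬝ᵥ (yk - ys)) + (1 / β) * ((lk - ls) ⬝ᵥ (lk - ls)) := by
  have h₁ := hstep.contraction_cross hβ hsol
  have h₂ := neg_two_mul_dotProduct_le (lp - lk) (B *ᵥ (yp - yk))
    (div_pos (mul_pos two_pos hε) hβ)
  have h₃ := mul_le_mul_of_nonneg_left (hcoerc (yp - yk)) hβ.le
  have e₁ : 1 / (2 * ε / β) = β * (1 / (2 * ε)) := by field_simp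
  have e₂ : (1 - 2 * ε) / β = 1 / β - 2 * ε / β := sub_div _ _ _
  rw [e₁] at h₂
  rw [e₂]
  linarith

/-- Theorem 3.3. -/
theorem stmt14 (hm : 0 < m) (hn₁ : 0 < n₁) (hn₂ : 0 < n₂)
    (A : Matrix (Fin m) (Fin n₁) ℝ) (B : Matrix (Fin m) (Fin n₂) ℝ) (b : Fin m → ℝ)
    (X : Set (Fin n₁ → ℝ)) (Y : Set (Fin n₂ → ℝ))
    (hXc : IsClosed X) (hXconv : Convex ℝ X) (hYc : IsClosed Y) (hYconv : Convex ℝ Y)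
    (θ₁ : (Fin n₁ → ℝ) → ℝ) (θ₂ : (Fin n₂ → ℝ) → ℝ)
    (hθ₁ : ConvexOn ℝ Set.univ θ₁) (hθ₂ : ConvexOn ℝ Set.univ θ₂)
    (β ε : ℝ) (hβ : 0 < β) (hε : ε ∈ Set.Ioo (0 : ℝ) (1 / 2))
    (xs : Fin n₁ → ℝ) (ys : Fin n₂ → ℝ) (ls : Fin m → ℝ)
    (hsol : VISolution A B b X Y θ₁ θ₂ xs ys ls)
    (δ : ℕ → ℝ) (hδ1 : ∀ k, 1 ≤ δ k)
    (hδsum : Summable (fun k => max 0 (δ (k + 1) - δ k)))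
    (c : ℝ) (hc : 0 < c)
    (hcoerc : ∀ (k : ℕ) (z : Fin n₂ → ℝ),
      δ k * (z ⬝ᵥ z) - (1 / (2 * ε)) * ((B *ᵥ z) ⬝ᵥ (B *ᵥ z)) ≥ c * (z ⬝ᵥ z))
    (x : ℕ → Fin n₁ → ℝ) (y : ℕ → Fin n₂ → ℝ) (l : ℕ → Fin m → ℝ)
    (hy0 : y 0 ∈ Y)
    (hstep : ∀ k : ℕ,
      ADMMStep A B b X Y θ₁ θ₂ β (δ k) (y k) (l k) (x (k + 1)) (y (k + 1)) (l (k + 1))) :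
    (∃ L : ℝ, Tendsto (fun k =>
        δ k * β * ((y (k + 1) - ys) ⬝ᵥ (y (k + 1) - ys))
          + (1 / β) * ((l (k + 1) - ls) ⬝ᵥ (l (k + 1) - ls))) atTop (nhds L)) ∧
      Tendsto (fun k => Real.sqrt ((y (k + 1) - y k) ⬝ᵥ (y (k + 1) - y k)))
        atTop (nhds 0) ∧
      Tendsto (fun k => Real.sqrt ((l (k + 1) - l k) ⬝ᵥ (l (k + 1) - l k)))
        atTop (nhds 0) := by
  have hdot : ∀ {p : ℕ} (u : Fin p → ℝ), 0 ≤ u ⬝ᵥ u := fun u =>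
    Finset.sum_nonneg fun i _ => mul_self_nonneg (u i)
  have hcβ : 0 < β * c := mul_pos hβ hc
  have hεβ : 0 < (1 - 2 * ε) / β := div_pos (by linarith [hε.2]) hβ
  obtain ⟨ha, hd⟩ := tendsto_of_add_le_one_add_mul
    (a := fun k => δ k * β * ((y (k + 1) - ys) ⬝ᵥ (y (k + 1) - ys))
      + (1 / β) * ((l (k + 1) - ls) ⬝ᵥ (l (k + 1) - ls)))
    (d := fun k => β * c * ((y (k + 1) - y k) ⬝ᵥ (y (k + 1) - y k))
      + (1 - 2 * ε) / β * ((l (k + 1) - l k) ⬝ᵥ (l (k + 1) - l k)))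
    (s := fun k => max 0 (δ (k + 1) - δ k))
    (fun k => add_nonneg
      (mul_nonneg (mul_nonneg (zero_le_one.trans (hδ1 k)) hβ.le) (hdot _))
      (mul_nonneg (one_div_pos.2 hβ).le (hdot _)))
    (fun k => add_nonneg (mul_nonneg hcβ.le (hdot _)) (mul_nonneg hεβ.le (hdot _)))
    (fun k => le_max_left _ _) hδsum (fun k => by
      refine ((hstep (k + 1)).contraction hβ hε.1 (hcoerc (k + 1)) hsol).trans ?_
      have hN := mul_nonneg hβ.le (hdot (y (k + 1) - ys))
      have hM := mul_nonneg (one_div_pos.2 hβ).le (hdot (l (k + 1) - ls))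
      have hs₀ : 0 ≤ max 0 (δ (k + 1) - δ k) := le_max_left _ _
      have hs : δ (k + 1) ≤ δ k + max 0 (δ (k + 1) - δ k) * δ k := by
        nlinarith [le_max_right 0 (δ (k + 1) - δ k), mul_le_mul_of_nonneg_left (hδ1 k) hs₀]
      have := mul_le_mul_of_nonneg_right hs hN
      have := mul_nonneg hs₀ hM
      linarith)
  have hsqrt : ∀ {f g : ℕ → ℝ} {t : ℝ}, 0 < t → (∀ k, 0 ≤ f k) → (∀ k, t * f k ≤ g k) →
      Tendsto g atTop (nhds 0) → Tendsto (fun k => Real.sqrt (f k)) atTop (nhds 0) := by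
    intro f g t ht hf hfg hg
    have hf₀ : Tendsto f atTop (nhds 0) :=
      squeeze_zero hf (fun k => (le_div_iff₀' ht).2 (hfg k)) (by simpa using hg.div_const t)
    rw [← Real.sqrt_zero]
    exact (Real.continuous_sqrt.tendsto 0).comp hf₀
  exact ⟨ha,
    hsqrt hcβ (fun k => hdot _)
      (fun k => le_add_of_nonneg_right (mul_nonneg hεβ.le (hdot _))) hd,
    hsqrt hεβ (fun k => hdot _)
      (fun k => le_add_of_nonneg_left (mul_nonneg hcβ.le (hdot _))) hd⟩
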